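/- arXiv:1911.02483 — 4 statements merged into one kernel-verified Lean document; each statement's English description precedes it below -/
import Mathlib

section
/- Let X be an a.s. continuous H-self-similar process (H ∈ (0,1)) with M_t = sup_{0≤s≤t} X_s, ℙ(M_1 > 0) = 1, and first passage times T_x = inf{t ≥ 0 : X_t ≥ x}. For x > 0 define the co-ascent at level x by X^a(x)_t = T_x^{-H} X_{T_x t}, t ≥ 0. Then for every x > 0 the process X^a(x) has the same law (as a random element of path space) as X^a(1); i.e., the law of the co-ascent process does not depend on the level x. -/
open MeasureTheory ProbabilityTheory Set Filter
open scoped NNReal ENNReal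

noncomputable section

/-- Rescaling of a path by factor `r` with index `H`: `(s_r f)_t = r^{-H} f(rt)`. -/
def scl (H : ℝ) (r : ℝ≥0) (f : ℝ≥0 → ℝ) : ℝ≥0 → ℝ := fun t => (r : ℝ) ^ (-H) * f (r * t)

/-- Running maximum `M_t = sup_{0 ≤ s ≤ t} f s`. -/
def runMax (f : ℝ≥0 → ℝ) (t : ℝ≥0) : ℝ := sSup (f '' Set.Iic t)

/-- First passage time `T_x = inf {t ≥ 0 : f t ≥ x}` (junk value `0` if the level is never reached). -/
def fpt (f : ℝ≥0 → ℝ) (x : ℝ) : ℝ≥0 := sInf {t : ℝ≥0 | x ≤ f t}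

/-- `H`-self-similarity of a process: for every `c > 0` the rescaled process
`(c^{-H} X_{ct})_{t ≥ 0}` has the same law as `X` on path space. -/
def SelfSimilar {Ω : Type*} [MeasurableSpace Ω] (P : Measure Ω) (H : ℝ)
    (X : Ω → ℝ≥0 → ℝ) : Prop :=
  ∀ c : ℝ≥0, 0 < c → Measure.map (fun ω => scl H c (X ω)) P = Measure.map (fun ω => X ω) P

/-- Extended first passage time at level one, via countably many evaluations. -/
def extT (f : ℝ≥0 → ℝ) : ℝ≥0∞ :=
  ⨆ n : ℕ, ⨅ k : ℕ, if 1 - 1 / ((n : ℝ) + 1) < f (TopologicalSpace.denseSeq ℝ≥0 k)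
    then ((TopologicalSpace.denseSeq ℝ≥0 k : ℝ≥0) : ℝ≥0∞) else ⊤

lemma measurable_extT : Measurable extT := by
  unfold extT
  refine Measurable.iSup fun n => Measurable.iInf fun k => ?_
  refine Measurable.ite ?_ measurable_const measurable_const
  exact measurableSet_lt measurable_const (measurable_pi_apply _)

lemma extT_eq (f : ℝ≥0 → ℝ) (hf : Continuous f) :
    extT f = ⨅ t : ℝ≥0, ⨅ _ : 1 ≤ f t, (t : ℝ≥0∞) := by
  apply le_antisymm
  · refine le_iInf fun t => le_iInf fun ht => iSup_le fun n => ?_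
    set I : ℝ≥0∞ := ⨅ k : ℕ, if 1 - 1 / ((n : ℝ) + 1) < f (TopologicalSpace.denseSeq ℝ≥0 k)
      then ((TopologicalSpace.denseSeq ℝ≥0 k : ℝ≥0) : ℝ≥0∞) else ⊤ with hI
    have hU : IsOpen {s : ℝ≥0 | 1 - 1 / ((n : ℝ) + 1) < f s} := isOpen_lt continuous_const hf
    have hcl : IsClosed {s : ℝ≥0 | I ≤ (s : ℝ≥0∞)} :=
      isClosed_le continuous_const ENNReal.continuous_coe
    have h1 := (TopologicalSpace.denseRange_denseSeq ℝ≥0).open_subset_closure_inter hU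
    have htU : t ∈ {s : ℝ≥0 | 1 - 1 / ((n : ℝ) + 1) < f s} := by
      have : (0 : ℝ) < 1 / ((n : ℝ) + 1) := by positivity
      simp only [mem_ofPred_eq]; linarith
    have h2 : closure ({s : ℝ≥0 | 1 - 1 / ((n : ℝ) + 1) < f s} ∩
        Set.range (TopologicalSpace.denseSeq ℝ≥0)) ⊆ {s : ℝ≥0 | I ≤ (s : ℝ≥0∞)} := by
      refine closure_minimal ?_ hcl
      rintro _ ⟨hs, k, rfl⟩
      change I ≤ _
      rw [hI]
      refine (iInf_le _ k).trans ?_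
      rw [mem_ofPred_eq] at hs
      rw [if_pos hs]
    exact h2 (h1 htU)
  · refine le_of_forall_gt_imp_ge_of_dense fun a ha => ?_
    obtain ⟨b, hb1, hb2⟩ := ENNReal.lt_iff_exists_nnreal_btwn.1 ha
    obtain ⟨t, ht, hmax⟩ := (isCompact_Icc (a := (0 : ℝ≥0)) (b := b)).exists_isMaxOn
      ⟨0, by simp⟩ hf.continuousOn
    have hft : 1 ≤ f t := by
      have key : ∀ n : ℕ, 1 - 1 / ((n : ℝ) + 1) ≤ f t := by
        intro n
        have h := (le_iSup (fun n : ℕ => ⨅ k : ℕ,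
          if 1 - 1 / ((n : ℝ) + 1) < f (TopologicalSpace.denseSeq ℝ≥0 k)
          then ((TopologicalSpace.denseSeq ℝ≥0 k : ℝ≥0) : ℝ≥0∞) else ⊤) n).trans_lt hb1
        obtain ⟨k, hk⟩ := iInf_lt_iff.1 h
        split_ifs at hk with hc
        · have := hmax (a := TopologicalSpace.denseSeq ℝ≥0 k)
            ⟨zero_le, by exact_mod_cast hk.le⟩
          exact hc.le.trans this
        · exact absurd hk (by simp)
      have hl : Tendsto (fun n : ℕ => 1 - 1 / ((n : ℝ) + 1)) atTop (nhds (1 - 0)) :=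
        tendsto_const_nhds.sub tendsto_one_div_add_atTop_nhds_zero_nat
      have := le_of_tendsto' hl key
      simpa using this
    refine (iInf₂_le t hft).trans ?_
    exact le_trans (by exact_mod_cast ht.2) hb2.le

lemma fpt_eq (f : ℝ≥0 → ℝ) (hf : Continuous f) : fpt f 1 = (extT f).toNNReal := by
  rw [extT_eq f hf]
  unfold fpt
  rcases Set.eq_empty_or_nonempty {t : ℝ≥0 | 1 ≤ f t} with h | h
  · have : ∀ t, ¬ 1 ≤ f t := fun t ht => by
      have : t ∈ {t : ℝ≥0 | 1 ≤ f t} := ht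
      rw [h] at this; exact this
    rw [h]; simp [this]
  · have := ENNReal.coe_sInf h
    have h2 : (⨅ t : ℝ≥0, ⨅ _ : 1 ≤ f t, (t : ℝ≥0∞)) = ((sInf {t : ℝ≥0 | 1 ≤ f t} : ℝ≥0) : ℝ≥0∞) := by
      rw [this]; rfl
    rw [h2, ENNReal.toNNReal_coe]

/-- Measurable version of the co-ascent functional. -/
def Psi (H : ℝ) (f : ℝ≥0 → ℝ) : ℝ≥0 → ℝ := fun t =>
  (((extT f).toNNReal : ℝ≥0) : ℝ) ^ (-H) *
    limsup (fun n : ℕ => f ((⌊(extT f).toNNReal * t * (n : ℝ≥0)⌋₊ : ℝ≥0) / (n : ℝ≥0))) atTop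

lemma measurable_Psi (H : ℝ) : Measurable (Psi H) := by
  have hT : Measurable fun f : ℝ≥0 → ℝ => (extT f).toNNReal := measurable_extT.ennreal_toNNReal
  refine measurable_pi_iff.2 fun t => ?_
  unfold Psi
  refine Measurable.mul (hT.coe_nnreal_real.pow_const _) ?_
  refine Measurable.limsup fun n => ?_
  have h1 : Measurable fun p : ℕ × (ℝ≥0 → ℝ) => p.2 ((p.1 : ℝ≥0) / (n : ℝ≥0)) :=
    measurable_from_prod_countable_right fun k => measurable_pi_apply ((k : ℝ≥0) / (n : ℝ≥0))
  have h2 : Measurable fun f : ℝ≥0 → ℝ => ⌊(extT f).toNNReal * t * (n : ℝ≥0)⌋₊ :=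
    Nat.measurable_floor.comp ((hT.mul_const _).mul_const _)
  exact h1.comp (h2.prodMk measurable_id)

lemma Psi_eq (H : ℝ) (f : ℝ≥0 → ℝ) (hf : Continuous f) : scl H (fpt f 1) f = Psi H f := by
  funext t
  unfold scl Psi
  rw [← fpt_eq f hf]
  congr 1
  symm
  apply Tendsto.limsup_eq
  refine (hf.tendsto _).comp ?_
  rw [← NNReal.tendsto_coe]
  have h := (tendsto_nat_floor_mul_div_atTop (R := ℝ) (a := ((fpt f 1 * t : ℝ≥0) : ℝ))
    (NNReal.coe_nonneg _)).comp (tendsto_natCast_atTop_atTop (R := ℝ))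
  refine h.congr fun n => ?_
  have e : ⌊((fpt f 1 * t : ℝ≥0) : ℝ) * (n : ℝ)⌋₊ = ⌊fpt f 1 * t * (n : ℝ≥0)⌋₊ := by
    refine eq_of_forall_le_iff fun m => ?_
    rw [Nat.le_floor_iff (by positivity), Nat.le_floor_iff zero_le, ← NNReal.coe_le_coe]
    push_cast
    rfl
  simp only [Function.comp_apply, e]
  push_cast
  rfl

lemma fpt_scl (H : ℝ) (hH : 0 < H) (x : ℝ) (hx : 0 < x) (c : ℝ≥0) (hc : 0 < c)
    (hcx : (c : ℝ) ^ (-H) = x⁻¹) (f : ℝ≥0 → ℝ) :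
    fpt f x = c * fpt (scl H c f) 1 := by
  have hset : {t : ℝ≥0 | x ≤ f t} = (fun t => c * t) '' {t : ℝ≥0 | 1 ≤ scl H c f t} := by
    ext t
    simp only [scl, hcx, mem_ofPred_eq, mem_image]
    have e : ∀ y : ℝ, 1 ≤ x⁻¹ * y ↔ x ≤ y := fun y => by
      rw [inv_mul_eq_div, one_le_div hx]
    simp only [e]
    constructor
    · intro h
      refine ⟨c⁻¹ * t, ?_, ?_⟩ <;> rw [mul_inv_cancel_left₀ hc.ne']
      exact h
    · rintro ⟨s, hs, rfl⟩; exact hs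
  unfold fpt
  rw [hset, sInf_image', ← NNReal.mul_iInf, sInf_eq_iInf']

lemma scl_fpt (H : ℝ) (hH : 0 < H) (x : ℝ) (hx : 0 < x) (c : ℝ≥0) (hc : 0 < c)
    (hcx : (c : ℝ) ^ (-H) = x⁻¹) (f : ℝ≥0 → ℝ) :
    scl H (fpt f x) f = scl H (fpt (scl H c f) 1) (scl H c f) := by
  rw [fpt_scl H hH x hx c hc hcx f]
  generalize fpt (scl H c f) 1 = T
  funext t
  simp only [scl, NNReal.coe_mul]
  rw [Real.mul_rpow c.coe_nonneg T.coe_nonneg, mul_assoc c T t]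
  ring

/-- the law of the co-ascent process `X^a(x)_t = T_x^{-H} X_{T_x t}` does not
depend on the level `x > 0`. -/
theorem statement6 {Ω : Type*} [MeasurableSpace Ω] (P : Measure Ω) [IsProbabilityMeasure P]
    (H : ℝ) (hH : H ∈ Set.Ioo (0 : ℝ) 1) (X : Ω → ℝ≥0 → ℝ) (hX : Measurable X)
    (hcont : ∀ᵐ ω ∂P, Continuous (X ω))
    (hss : SelfSimilar P H X)
    (hM1 : ∀ᵐ ω ∂P, 0 < runMax (X ω) 1)
    (x : ℝ) (hx : 0 < x) :
    Measure.map (fun ω => scl H (fpt (X ω) x) (X ω)) P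
      = Measure.map (fun ω => scl H (fpt (X ω) 1) (X ω)) P := by
  obtain ⟨hH0, -⟩ := hH
  set c : ℝ≥0 := ⟨x ^ (1 / H), (Real.rpow_pos_of_pos hx _).le⟩ with hcdef
  have hc : 0 < c := Real.rpow_pos_of_pos hx _
  have hcx : (c : ℝ) ^ (-H) = x⁻¹ := by
    change (x ^ (1 / H)) ^ (-H) = x⁻¹
    rw [← Real.rpow_mul hx.le, show 1 / H * -H = -1 by field_simp, Real.rpow_neg_one]
  have hY : Measurable fun ω => scl H c (X ω) := by
    refine measurable_pi_iff.2 fun t => ?_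
    exact ((measurable_pi_apply _).comp hX).const_mul _
  have h1 : (fun ω => scl H (fpt (X ω) x) (X ω)) =ᵐ[P] fun ω => Psi H (scl H c (X ω)) := by
    filter_upwards [hcont] with ω hω
    rw [scl_fpt H hH0 x hx c hc hcx, Psi_eq]
    unfold scl
    fun_prop
  have h2 : (fun ω => scl H (fpt (X ω) 1) (X ω)) =ᵐ[P] fun ω => Psi H (X ω) := by
    filter_upwards [hcont] with ω hω
    exact Psi_eq H _ hω
  rw [Measure.map_congr h1, Measure.map_congr h2]
  have e1 := Measure.map_map (μ := P) (measurable_Psi H) hY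
  have e2 := Measure.map_map (μ := P) (measurable_Psi H) hX
  have e3 := hss c hc
  change _ = Measure.map X P at e3
  rw [e3, e2] at e1
  exact e1.symm
end
end

section
/- Let X be an a.s. continuous H-self-similar process (H ∈ (0,1)) with M_t = sup_{0≤s≤t} X_s, ℙ(M_1 > 0) = 1, T_1 = inf{t ≥ 0 : X_t ≥ 1}, and co-ascent process X^a_t = T_1^{-H} X_{T_1 t}. Then for every x > 0, ℙ(X^a_t ≤ x for all 0 ≤ t ≤ 1) = ℙ(X_t ≤ x for all 0 ≤ t ≤ 1); i.e., the co-ascent process on [0,1] has the same persistence probabilities as X itself. -/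
open MeasureTheory ProbabilityTheory Set Filter
open scoped NNReal ENNReal

noncomputable section

/-- The (extended) co-ascent process `X^a_t = T_1^{-H} X_{T_1 t}` of a path. -/
def coAscent (H : ℝ) (f : ℝ≥0 → ℝ) : ℝ≥0 → ℝ := scl H (fpt f 1) f


def Qset (y : ℝ) : Set (ℝ≥0 → ℝ) :=
  {f | ∀ n : ℕ, f (TopologicalSpace.denseSeq (Set.Iic (1 : ℝ≥0)) n : ℝ≥0) ≤ y}

lemma Qset_meas (y : ℝ) : MeasurableSet (Qset y) := by
  have : Qset y = ⋂ n : ℕ, {f : ℝ≥0 → ℝ |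
      f (TopologicalSpace.denseSeq (Set.Iic (1 : ℝ≥0)) n : ℝ≥0) ≤ y} := by
    ext f; simp [Qset]
  rw [this]
  exact MeasurableSet.iInter fun n =>
    measurableSet_le (measurable_pi_apply _) measurable_const

lemma mem_Qset {f : ℝ≥0 → ℝ} (hf : Continuous f) (y : ℝ) :
    f ∈ Qset y ↔ ∀ t : ℝ≥0, t ≤ 1 → f t ≤ y := by
  constructor
  · intro h t ht
    have hc : IsClosed {a : Set.Iic (1 : ℝ≥0) | f a ≤ y} :=
      isClosed_le (hf.comp continuous_subtype_val) continuous_const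
    exact isClosed_property (TopologicalSpace.denseRange_denseSeq (Set.Iic (1 : ℝ≥0))) hc h ⟨t, ht⟩
  · intro h n
    exact h _ (TopologicalSpace.denseSeq (Set.Iic (1 : ℝ≥0)) n).2

lemma scl_cont (H : ℝ) (c : ℝ≥0) {f : ℝ≥0 → ℝ} (hf : Continuous f) : Continuous (scl H c f) := by
  unfold scl
  exact continuous_const.mul (hf.comp (continuous_const.mul continuous_id))

lemma scl_meas (H : ℝ) (c : ℝ≥0) : Measurable (scl H c) := by
  unfold scl
  exact measurable_pi_lambda _ fun t => (measurable_pi_apply _).const_mul _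

lemma scl_le (H : ℝ) {c : ℝ≥0} (hc : 0 < c) (f : ℝ≥0 → ℝ) (y : ℝ) :
    (∀ t : ℝ≥0, t ≤ 1 → scl H c f t ≤ y) ↔ ∀ t : ℝ≥0, t ≤ c → f t ≤ (c : ℝ) ^ H * y := by
  have hc' : (0 : ℝ) < c := hc
  have hp : (0 : ℝ) < (c : ℝ) ^ H := Real.rpow_pos_of_pos hc' _
  have key : ∀ z : ℝ, (c : ℝ) ^ (-H) * z ≤ y ↔ z ≤ (c : ℝ) ^ H * y := by
    intro z
    rw [Real.rpow_neg hc'.le, inv_mul_le_iff₀ hp]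
  constructor
  · intro h t ht
    have h1 := h (t / c) (by rwa [div_le_one hc])
    unfold scl at h1
    rw [key, mul_div_cancel₀ _ hc.ne'] at h1
    exact h1
  · intro h t ht
    unfold scl
    rw [key]
    exact h _ (mul_le_of_le_one_right' ht)

section
variable {Ω : Type*} [MeasurableSpace Ω] (P : Measure Ω) [IsProbabilityMeasure P]
    (H : ℝ) (X : Ω → ℝ≥0 → ℝ) (hX : Measurable X)
    (hcont : ∀ᵐ ω ∂P, Continuous (X ω))
    (hss : SelfSimilar P H X)

/-- The event that the path stays below `y` on `[0,c]`. -/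
def Sset {Ω : Type*} (X : Ω → ℝ≥0 → ℝ) (c : ℝ≥0) (y : ℝ) : Set Ω := {ω | ∀ t : ℝ≥0, t ≤ c → X ω t ≤ y}

lemma Sset_ae {Ω : Type*} [MeasurableSpace Ω] (P : Measure Ω)
    (H : ℝ) (X : Ω → ℝ≥0 → ℝ)
    (hcont : ∀ᵐ ω ∂P, Continuous (X ω)) {c : ℝ≥0} (hc : 0 < c) (y : ℝ) :
    Sset X c ((c : ℝ) ^ H * y) =ᵐ[P] (fun ω => scl H c (X ω)) ⁻¹' Qset y := by
  filter_upwards [hcont] with ω hω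
  apply propext
  change (∀ t : ℝ≥0, t ≤ c → X ω t ≤ (c : ℝ) ^ H * y) ↔ scl H c (X ω) ∈ Qset y
  rw [mem_Qset (scl_cont H c hω), scl_le H hc]

lemma Sset_null {Ω : Type*} [MeasurableSpace Ω] (P : Measure Ω)
    (H : ℝ) (X : Ω → ℝ≥0 → ℝ) (hX : Measurable X)
    (hcont : ∀ᵐ ω ∂P, Continuous (X ω)) {c : ℝ≥0} (hc : 0 < c) (y : ℝ) :
    NullMeasurableSet (Sset X c ((c : ℝ) ^ H * y)) P :=
  (((scl_meas H c).comp hX) (Qset_meas y)).nullMeasurableSet.congr (Sset_ae P H X hcont hc y).symm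

lemma Sset_prob {Ω : Type*} [MeasurableSpace Ω] (P : Measure Ω)
    (H : ℝ) (X : Ω → ℝ≥0 → ℝ) (hX : Measurable X)
    (hcont : ∀ᵐ ω ∂P, Continuous (X ω)) (hss : SelfSimilar P H X) {c : ℝ≥0} (hc : 0 < c) (y : ℝ) :
    P (Sset X c ((c : ℝ) ^ H * y)) = P (Sset X 1 y) := by
  have h1 : Sset X 1 y =ᵐ[P] X ⁻¹' Qset y := by
    filter_upwards [hcont] with ω hω
    exact propext (mem_Qset hω y).symm
  rw [measure_congr (Sset_ae P H X hcont hc y), measure_congr h1]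
  have h := congrArg (fun μ => μ (Qset y)) (hss c hc)
  beta_reduce at h
  rw [Measure.map_apply (f := fun ω => scl H c (X ω)) ((scl_meas H c).comp hX) (Qset_meas y),
    Measure.map_apply (f := fun ω => X ω) hX (Qset_meas y)] at h
  exact h

end

lemma zero_lt {Ω : Type*} [MeasurableSpace Ω] (P : Measure Ω) [IsProbabilityMeasure P]
    (H : ℝ) (hH : 0 < H) (X : Ω → ℝ≥0 → ℝ) (hX : Measurable X)
    (hss : SelfSimilar P H X) : ∀ᵐ ω ∂P, X ω 0 < 1 := by
  have hm : ∀ a : ℝ, MeasurableSet {f : ℝ≥0 → ℝ | a ≤ f 0} := fun a =>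
    measurableSet_le measurable_const (measurable_pi_apply _)
  have heq : ∀ n : ℕ, P {ω | 1 ≤ X ω 0} = P {ω | (n : ℝ) + 1 ≤ X ω 0} := by
    intro n
    have hn : (0 : ℝ) < (n : ℝ) + 1 := by positivity
    set c : ℝ≥0 := ⟨((n : ℝ) + 1) ^ (H⁻¹), by positivity⟩ with hcdef
    have hc : 0 < c := by
      rw [← NNReal.coe_pos]; exact Real.rpow_pos_of_pos hn _
    have hcH : (c : ℝ) ^ H = (n : ℝ) + 1 := by
      change (((n : ℝ) + 1) ^ (H⁻¹)) ^ H = _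
      exact Real.rpow_inv_rpow hn.le hH.ne'
    have h := congrArg (fun μ => μ {f : ℝ≥0 → ℝ | 1 ≤ f 0}) (hss c hc)
    beta_reduce at h
    rw [Measure.map_apply (f := fun ω => scl H c (X ω)) ((scl_meas H c).comp hX) (hm 1), Measure.map_apply (f := fun ω => X ω) hX (hm 1)] at h
    refine (Eq.trans ?_ h.symm).trans ?_
    · rfl
    · congr 1
      ext ω
      simp only [mem_preimage, mem_ofPred_eq, scl, mul_zero]
      rw [Real.rpow_neg (NNReal.coe_nonneg c), hcH, le_inv_mul_iff₀ hn, mul_one]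
  have hlim : Tendsto (fun n : ℕ => P {ω | (n : ℝ) + 1 ≤ X ω 0}) atTop
      (nhds (P (⋂ n : ℕ, {ω | (n : ℝ) + 1 ≤ X ω 0}))) := by
    apply tendsto_measure_iInter_atTop
    · intro n
      exact (hX (hm _)).nullMeasurableSet
    · intro m n hmn ω hω
      have : (m : ℝ) ≤ n := by exact_mod_cast hmn
      simp only [mem_ofPred_eq] at hω ⊢
      linarith
    · exact ⟨0, measure_ne_top _ _⟩
  have hempty : (⋂ n : ℕ, {ω | (n : ℝ) + 1 ≤ X ω 0}) = ∅ := by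
    ext ω
    simp only [mem_iInter, mem_ofPred_eq, mem_empty_iff_false, iff_false, not_forall, not_le]
    obtain ⟨n, hn⟩ := exists_nat_gt (X ω 0)
    exact ⟨n, by linarith⟩
  rw [hempty, measure_empty] at hlim
  simp_rw [← heq] at hlim
  have h0 := tendsto_nhds_unique tendsto_const_nhds hlim
  rw [ae_iff]
  simpa using h0

lemma exists_ge {Ω : Type*} [MeasurableSpace Ω] (P : Measure Ω) [IsProbabilityMeasure P]
    (H : ℝ) (hH : 0 < H) (X : Ω → ℝ≥0 → ℝ) (hX : Measurable X)
    (hcont : ∀ᵐ ω ∂P, Continuous (X ω)) (hss : SelfSimilar P H X)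
    (hM1 : ∀ᵐ ω ∂P, 0 < runMax (X ω) 1) : ∀ᵐ ω ∂P, ∃ t, 1 ≤ X ω t := by
  have hle : ∀ n : ℕ, P {ω | ∀ t, X ω t < 1} ≤ P (Sset X 1 (((n : ℝ) + 1)⁻¹)) := by
    intro n
    have hn : (0 : ℝ) < (n : ℝ) + 1 := by positivity
    set c : ℝ≥0 := ⟨((n : ℝ) + 1) ^ (H⁻¹), by positivity⟩ with hcdef
    have hc : 0 < c := by
      rw [← NNReal.coe_pos]; exact Real.rpow_pos_of_pos hn _
    have hcH : (c : ℝ) ^ H = (n : ℝ) + 1 := by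
      change (((n : ℝ) + 1) ^ (H⁻¹)) ^ H = _
      exact Real.rpow_inv_rpow hn.le hH.ne'
    rw [← Sset_prob P H X hX hcont hss hc]
    apply measure_mono
    intro ω hω t ht
    rw [hcH, mul_inv_cancel₀ hn.ne']
    exact (hω t).le
  have hlim : Tendsto (fun n : ℕ => P (Sset X 1 (((n : ℝ) + 1)⁻¹))) atTop
      (nhds (P (⋂ n : ℕ, Sset X 1 (((n : ℝ) + 1)⁻¹)))) := by
    apply tendsto_measure_iInter_atTop
    · intro n
      have := Sset_null P H X hX hcont one_pos (((n : ℝ) + 1)⁻¹)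
      simpa using this
    · intro m n hmn ω hω t ht
      have : (m : ℝ) ≤ n := by exact_mod_cast hmn
      refine (hω t ht).trans ?_
      gcongr
    · exact ⟨0, measure_ne_top _ _⟩
  have hzero : P (⋂ n : ℕ, Sset X 1 (((n : ℝ) + 1)⁻¹)) = 0 := by
    rw [ae_iff] at hM1
    refine measure_mono_null ?_ hM1
    intro ω hω
    simp only [mem_iInter] at hω
    simp only [mem_ofPred_eq, not_lt]
    apply Real.sSup_nonpos
    rintro _ ⟨t, ht, rfl⟩
    have h2 : Tendsto (fun n : ℕ => ((n : ℝ) + 1)⁻¹) atTop (nhds 0) := by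
      simpa using tendsto_one_div_add_atTop_nhds_zero_nat (𝕜 := ℝ)
    exact ge_of_tendsto' h2 fun n => hω n t ht
  rw [hzero] at hlim
  have h0 : P {ω | ∀ t, X ω t < 1} ≤ 0 := ge_of_tendsto' hlim hle
  rw [ae_iff]
  simpa using h0

lemma le_of_lt_closure {f : ℝ≥0 → ℝ} (hf : Continuous f) {T : ℝ≥0} (hT : 0 < T)
    (h : ∀ t < T, f t < 1) : ∀ t ≤ T, f t ≤ 1 := by
  intro t ht
  have hc : IsClosed {t : ℝ≥0 | f t ≤ 1} := isClosed_le hf continuous_const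
  have h1 : closure (Set.Iio T) ⊆ {t : ℝ≥0 | f t ≤ 1} :=
    closure_minimal (fun s hs => (h s hs).le) hc
  rw [closure_Iio' (a := T) ⟨0, mem_Iio.mpr hT⟩] at h1
  exact h1 ht

lemma det_iff (H : ℝ) (hH : 0 < H) {f : ℝ≥0 → ℝ} (hf : Continuous f) (h0 : f 0 < 1)
    (h1 : ∃ t, 1 ≤ f t) {c : ℝ≥0} (hc : 0 < c) :
    (∀ t : ℝ≥0, t ≤ 1 → coAscent H f t ≤ (c : ℝ) ^ (-H)) ↔ ∀ t < c, f t < 1 := by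
  have hclosed : IsClosed {t : ℝ≥0 | (1 : ℝ) ≤ f t} := isClosed_le continuous_const hf
  have hmem : 1 ≤ f (fpt f 1) := hclosed.csInf_mem h1 (OrderBot.bddBelow _)
  have hlt : ∀ t < fpt f 1, f t < 1 := by
    intro t ht
    by_contra hcon
    exact notMem_of_lt_csInf ht (OrderBot.bddBelow _) (not_lt.mp hcon)
  have hT : 0 < fpt f 1 := by
    rw [pos_iff_ne_zero]
    intro h
    rw [h] at hmem
    linarith
  have hiff : (∀ t < c, f t < 1) ↔ c ≤ fpt f 1 := by
    constructor
    · intro h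
      by_contra hcon
      have := h _ (not_le.mp hcon)
      linarith
    · intro h t ht
      exact hlt t (ht.trans_le h)
  rw [hiff]
  unfold coAscent
  set T := fpt f 1 with hTdef
  have hT' : (0 : ℝ) < T := hT
  have hc' : (0 : ℝ) < c := hc
  have hp : (0 : ℝ) < (T : ℝ) ^ (-H) := Real.rpow_pos_of_pos hT' _
  have hpow : (T : ℝ) ^ (-H) ≤ (c : ℝ) ^ (-H) ↔ c ≤ T := by
    rw [Real.rpow_le_rpow_iff_of_neg hT' hc' (by linarith)]
    exact NNReal.coe_le_coe
  rw [← hpow]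
  constructor
  · intro h
    have h2 := h 1 le_rfl
    unfold scl at h2
    rw [mul_one] at h2
    nlinarith
  · intro h t ht
    unfold scl
    have h3 := le_of_lt_closure hf hT hlt (T * t) (mul_le_of_le_one_right' ht)
    nlinarith

lemma prob_A {Ω : Type*} [MeasurableSpace Ω] (P : Measure Ω) [IsProbabilityMeasure P]
    (H : ℝ) (hH : 0 < H) (X : Ω → ℝ≥0 → ℝ) (hX : Measurable X)
    (hcont : ∀ᵐ ω ∂P, Continuous (X ω)) (hss : SelfSimilar P H X) {c : ℝ≥0} (hc : 0 < c) :
    P {ω | ∀ t < c, X ω t < 1} = P (Sset X 1 ((c : ℝ) ^ (-H))) := by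
  have hc' : (0 : ℝ) < c := hc
  apply le_antisymm
  · rw [← Sset_prob P H X hX hcont hss hc]
    apply measure_mono_ae
    filter_upwards [hcont] with ω hω
    intro (h : ∀ t < c, X ω t < 1)
    change ∀ t ≤ c, X ω t ≤ _
    rw [← Real.rpow_add hc', add_neg_cancel, Real.rpow_zero]
    exact le_of_lt_closure hω hc h
  · obtain ⟨u, hmono, hu, hlim⟩ := exists_seq_strictMono_tendsto' hc
    set p := P (Sset X 1 ((c : ℝ) ^ (-H))) with hp
    have hcompl : P ({ω | ∀ t < c, X ω t < 1}ᶜ) ≤ 1 - p := by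
      have hsub : {ω | ∀ t < c, X ω t < 1}ᶜ ⊆ ⋃ n : ℕ, {ω | ∃ t ≤ u n, 1 ≤ X ω t} := by
        intro ω hω
        simp only [mem_compl_iff, mem_ofPred_eq, not_forall, not_lt] at hω
        obtain ⟨t, ht, h1⟩ := hω
        obtain ⟨n, hn⟩ := (hlim.eventually (lt_mem_nhds ht)).exists
        exact mem_iUnion.mpr ⟨n, t, hn.le, h1⟩
      have hm : Monotone fun n : ℕ => {ω | ∃ t ≤ u n, 1 ≤ X ω t} := by
        rintro m n hmn ω ⟨t, ht, h1⟩
        exact ⟨t, ht.trans (hmono.monotone hmn), h1⟩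
      refine (measure_mono hsub).trans ?_
      rw [hm.measure_iUnion]
      apply iSup_le
      intro n
      have hun : 0 < u n := (hu n).1
      have hun' : (0 : ℝ) < u n := hun
      have hlt : ((u n : ℝ≥0) : ℝ) ^ H * (c : ℝ) ^ (-H) < 1 := by
        rw [Real.rpow_neg hc'.le, ← div_eq_mul_inv, div_lt_one (Real.rpow_pos_of_pos hc' _)]
        exact Real.rpow_lt_rpow hun'.le (by exact_mod_cast (hu n).2) hH
      have hsub2 : {ω | ∃ t ≤ u n, 1 ≤ X ω t} ⊆
          (Sset X (u n) (((u n : ℝ≥0) : ℝ) ^ H * (c : ℝ) ^ (-H)))ᶜ := by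
        rintro ω ⟨t, ht, h1⟩ hS
        have := hS t ht
        linarith
      refine (measure_mono hsub2).trans ?_
      rw [prob_compl_eq_one_sub₀ (Sset_null P H X hX hcont hun _),
        Sset_prob P H X hX hcont hss hun]
    have h1 : (1 : ℝ≥0∞) ≤ P {ω | ∀ t < c, X ω t < 1} + P ({ω | ∀ t < c, X ω t < 1}ᶜ) := by
      rw [← measure_univ (μ := P), ← union_compl_self {ω | ∀ t < c, X ω t < 1}]
      exact measure_union_le _ _
    have h2 : (1 : ℝ≥0∞) ≤ P {ω | ∀ t < c, X ω t < 1} + (1 - p) := h1.trans (by gcongr)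
    have hp1 : p ≤ 1 := prob_le_one
    have h3 : p + (1 - p) ≤ P {ω | ∀ t < c, X ω t < 1} + (1 - p) := by
      rwa [add_tsub_cancel_of_le hp1]
    exact (ENNReal.add_le_add_iff_right (ne_top_of_le_ne_top ENNReal.one_ne_top tsub_le_self)).mp h3

/-- the co-ascent process on `[0,1]` has the same persistence probabilities
as the original process: `ℙ(X^a_t ≤ x, 0 ≤ t ≤ 1) = ℙ(X_t ≤ x, 0 ≤ t ≤ 1)` for all `x > 0`. -/
theorem statement10 {Ω : Type*} [MeasurableSpace Ω] (P : Measure Ω) [IsProbabilityMeasure P]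
    (H : ℝ) (hH : H ∈ Set.Ioo (0 : ℝ) 1) (X : Ω → ℝ≥0 → ℝ) (hX : Measurable X)
    (hcont : ∀ᵐ ω ∂P, Continuous (X ω))
    (hss : SelfSimilar P H X)
    (hM1 : ∀ᵐ ω ∂P, 0 < runMax (X ω) 1) :
    ∀ x : ℝ, 0 < x →
      P {ω | ∀ t : ℝ≥0, t ≤ 1 → coAscent H (X ω) t ≤ x}
        = P {ω | ∀ t : ℝ≥0, t ≤ 1 → X ω t ≤ x} := by
  intro x hx
  have hH0 : 0 < H := hH.1
  set c : ℝ≥0 := ⟨x ^ ((-H)⁻¹), by positivity⟩ with hcdef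
  have hc : 0 < c := by
    rw [← NNReal.coe_pos]; exact Real.rpow_pos_of_pos hx _
  have hcH : (c : ℝ) ^ (-H) = x := by
    change (x ^ ((-H)⁻¹)) ^ (-H) = _
    exact Real.rpow_inv_rpow hx.le (by linarith)
  have hA := prob_A P H hH0 X hX hcont hss hc
  rw [hcH] at hA
  refine Eq.trans ?_ hA
  apply measure_congr
  filter_upwards [hcont, zero_lt P H hH0 X hX hss, exists_ge P H hH0 X hX hcont hss hM1]
    with ω h1 h2 h3
  have := det_iff H hH0 h1 h2 h3 hc
  rw [hcH] at this
  exact propext this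
end
end

section
/- Let f : [0,∞) → ℝ be continuous with f(0) = 0, H ∈ (0,1), and let μ_f be the record measure of f (the Stieltjes measure on (0,∞) of t ↦ max(sup_{0≤s≤t} f(s), 0)). For a bounded measurable function g : C([0,∞),ℝ) → [0,∞) define the measure (μ_f)_g on (0,∞) by (μ_f)_g(A) = ∫_A g(s_r f) μ_f(dr), where (s_r f)_t = r^{-H} f(rt). Then rescaling commutes with this operation: for every t > 0 and every Borel set B ⊆ (0,∞), (μ_{s_t f})_g(B) = t^{-H} (μ_f)_g(tB); that is, s_t((μ_f)_g) = (μ_{s_t f})_g = (s_t μ_f)_g. -/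
open MeasureTheory ProbabilityTheory Set Filter
open scoped NNReal ENNReal

noncomputable section

lemma scl_scl (H : ℝ) (r t : ℝ≥0) (f : ℝ≥0 → ℝ) : scl H r (scl H t f) = scl H (t * r) f := by
  funext x
  simp only [scl, NNReal.coe_mul]
  rw [Real.mul_rpow (NNReal.coe_nonneg t) (NNReal.coe_nonneg r), mul_assoc t r x]
  ring

lemma runMax_scl (H : ℝ) (t : ℝ≥0) (ht : 0 < t) (f : ℝ≥0 → ℝ) (u : ℝ≥0) :
    runMax (scl H t f) u = (t : ℝ) ^ (-H) * runMax f (t * u) := by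
  have h0 : (0 : ℝ) ≤ (t : ℝ) ^ (-H) := Real.rpow_nonneg t.2 _
  unfold runMax
  rw [← smul_eq_mul, ← Real.sSup_smul_of_nonneg h0]
  congr 1
  ext y
  simp only [Set.mem_image, Set.mem_Iic, Set.mem_smul_set, scl, smul_eq_mul]
  constructor
  · rintro ⟨x, hx, rfl⟩
    exact ⟨f (t * x), ⟨t * x, by gcongr, rfl⟩, rfl⟩
  · rintro ⟨_, ⟨x, hx, rfl⟩, rfl⟩
    refine ⟨t⁻¹ * x, ?_, ?_⟩
    · rw [inv_mul_le_iff₀ ht]; exact hx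
    · rw [mul_inv_cancel_left₀ ht.ne']

lemma measure_Iic_of (μ : Measure ℝ≥0) (h0 : μ {0} = 0) (u : ℝ≥0) :
    μ (Set.Iic u) = μ (Set.Ioc 0 u) := by
  refine le_antisymm ?_ (measure_mono fun x hx => hx.2)
  have : Set.Iic u ⊆ {0} ∪ Set.Ioc 0 u := by
    intro x hx
    rcases eq_or_ne x 0 with h | h
    · exact Or.inl h
    · exact Or.inr ⟨pos_iff_ne_zero.2 h, hx⟩
  calc μ (Set.Iic u) ≤ μ ({0} ∪ Set.Ioc 0 u) := measure_mono this
    _ ≤ μ {0} + μ (Set.Ioc 0 u) := measure_union_le _ _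
    _ = _ := by rw [h0, zero_add]

/-- rescaling commutes with the operation `(μ_f)_g(A) = ∫_A g(s_r f) μ_f(dr)`:
for every `t > 0` and Borel `B ⊆ (0,∞)`, `(μ_{s_t f})_g(B) = t^{-H} (μ_f)_g(tB)`, i.e.
`s_t((μ_f)_g) = (μ_{s_t f})_g = (s_t μ_f)_g`. Here `μ` is the record measure of `f` and
`ν` the record measure of `s_t f`, both characterised by their values on intervals `(0,u]`. -/
theorem statement16 (H : ℝ) (hH : H ∈ Set.Ioo (0 : ℝ) 1) (f : ℝ≥0 → ℝ)
    (hf : Continuous f) (hf0 : f 0 = 0)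
    (g : (ℝ≥0 → ℝ) → ℝ≥0∞) (hg : Measurable g)
    (hgbd : ∃ Cb : ℝ≥0∞, Cb ≠ ⊤ ∧ ∀ h, g h ≤ Cb)
    (t : ℝ≥0) (ht : 0 < t)
    (μ ν : Measure ℝ≥0)
    (hμ0 : μ {0} = 0)
    (hμ : ∀ u : ℝ≥0, 0 < u → μ (Set.Ioc 0 u) = ENNReal.ofReal (max (runMax f u) 0))
    (hν0 : ν {0} = 0)
    (hν : ∀ u : ℝ≥0, 0 < u → ν (Set.Ioc 0 u) = ENNReal.ofReal (max (runMax (scl H t f) u) 0)) :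
    ∀ B : Set ℝ≥0, MeasurableSet B → B ⊆ Set.Ioi 0 →
      ∫⁻ r in B, g (scl H r (scl H t f)) ∂ν
        = ENNReal.ofReal ((t : ℝ) ^ (-H)) * ∫⁻ r in (fun a => t * a) '' B, g (scl H r f) ∂μ := by
  intro B hB _
  have hc : (0 : ℝ) ≤ (t : ℝ) ^ (-H) := Real.rpow_nonneg t.2 _
  let e : ℝ≥0 ≃ᵐ ℝ≥0 := MeasurableEquiv.mulLeft₀ t ht.ne'
  have he : ∀ x, e x = t * x := fun x => rfl
  have hpre : ∀ s : Set ℝ≥0, e.symm ⁻¹' s = (fun a => t * a) '' s := fun s =>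
    (e.toEquiv.image_eq_preimage_symm s).symm
  have hIic : ∀ u, ν (Set.Iic u) ≠ ⊤ := by
    intro u
    rw [measure_Iic_of ν hν0]
    rcases eq_or_ne u 0 with h | h
    · simp [h]
    · rw [hν u (pos_iff_ne_zero.2 h)]; exact ENNReal.ofReal_ne_top
  have hmeas : ν = ENNReal.ofReal ((t : ℝ) ^ (-H)) • μ.map e.symm := by
    refine Measure.ext_of_generateFrom_of_iUnion (Set.range Set.Iic) (fun n : ℕ => Set.Iic (n : ℝ≥0))
      ?_ isPiSystem_Iic ?_ (fun n => ⟨_, rfl⟩) (fun n => hIic _) ?_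
    · rw [← borel_eq_generateFrom_Iic]; exact BorelSpace.measurable_eq
    · refine Set.eq_univ_of_forall fun x => Set.mem_iUnion.2 ?_
      exact exists_nat_ge x
    · rintro _ ⟨u, rfl⟩
      have h1 : e.symm ⁻¹' (Set.Iic u) = Set.Iic (t * u) := by
        rw [hpre]
        ext y
        simp only [Set.mem_image, Set.mem_Iic]
        constructor
        · rintro ⟨x, hx, rfl⟩
          gcongr
        · intro hy
          exact ⟨t⁻¹ * y, by rw [inv_mul_le_iff₀ ht]; exact hy, mul_inv_cancel_left₀ ht.ne' y⟩
      rw [Measure.smul_apply, MeasurableEquiv.map_apply, h1, measure_Iic_of ν hν0,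
        measure_Iic_of μ hμ0, smul_eq_mul]
      rcases eq_or_ne u 0 with h | h
      · simp [h]
      · have hu := pos_iff_ne_zero.2 h
        rw [hν u hu, hμ _ (mul_pos ht hu), runMax_scl H t ht, ← ENNReal.ofReal_mul hc,
          mul_max_of_nonneg _ _ hc, mul_zero]
  rw [hmeas, Measure.restrict_smul, lintegral_smul_measure, smul_eq_mul,
    MeasurableEquiv.restrict_map, lintegral_map_equiv, hpre]
  congr 1
  refine lintegral_congr fun r => ?_
  rw [scl_scl, ← he, MeasurableEquiv.apply_symm_apply]
end
end

section
/- Let B = (B_t)_{t≥0} be a standard one-dimensional Brownian motion (an a.s. continuous centered Gaussian process with B_0 = 0 and Cov(B_s, B_t) = min(s,t)), let T_1 = inf{t ≥ 0 : B_t = 1}, and let B^a_t = T_1^{-1/2} B_{T_1 t} be the extended Brownian co-ascent. Then the process (B^a_{1+s} − B^a_1)_{s≥0} is again a standard Brownian motion, and it is independent of the process (B^a_s)_{0≤s≤1}. -/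
open MeasureTheory ProbabilityTheory Set Filter
open scoped NNReal ENNReal

noncomputable section

/-- A standard one-dimensional Brownian motion: an a.s. continuous process starting at `0`
which is a centred Gaussian process with covariance `Cov(B_s, B_t) = min s t`, expressed by
requiring every finite linear combination `∑ cᵢ B_{tᵢ}` to be centred Gaussian with the
corresponding variance `∑ᵢ∑ⱼ cᵢ cⱼ min(tᵢ, tⱼ)`. -/
def IsStdBrownian {Ω : Type*} [MeasurableSpace Ω] (P : Measure Ω) (B : Ω → ℝ≥0 → ℝ) : Prop :=
  (∀ᵐ ω ∂P, Continuous (B ω)) ∧ (∀ᵐ ω ∂P, B ω 0 = 0) ∧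
    ∀ (n : ℕ) (c : Fin n → ℝ) (t : Fin n → ℝ≥0),
      Measure.map (fun ω => ∑ i, c i * B ω (t i)) P
        = gaussianReal 0 (∑ i, ∑ j, c i * c j * min ((t i : ℝ)) ((t j : ℝ))).toNNReal

/-- The first hitting time of level `1`: `T_1 = inf {t ≥ 0 : f t = 1}`. -/
def hitOne (f : ℝ≥0 → ℝ) : ℝ≥0 := sInf {t : ℝ≥0 | f t = 1}

/-- The extended Brownian co-ascent `B^a_t = T_1^{-1/2} B_{T_1 t}`. -/
def brownianCoAscent (B : ℝ≥0 → ℝ) : ℝ≥0 → ℝ :=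
  fun t => ((hitOne B : ℝ≥0) : ℝ) ^ (-(1 / 2 : ℝ)) * B (hitOne B * t)

/-- The frozen notion of Brownian motion gives Mathlib's pre-Brownian motion. -/
theorem IsStdBrownian.pre {Ω : Type*} [MeasurableSpace Ω] {P : Measure Ω} [IsProbabilityMeasure P]
    {B : Ω → ℝ≥0 → ℝ} (hB : Measurable B) (hBM : IsStdBrownian P B) :
    IsPreBrownianReal (fun t ω => B ω t) P := by
  obtain ⟨-, -, h⟩ := hBM
  have hm : ∀ t, Measurable (fun ω => B ω t) := fun t => (measurable_pi_apply t).comp hB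
  have hG : IsGaussianProcess (fun t ω => B ω t) P := by
    refine ⟨fun I => ⟨isGaussian_of_map_eq_gaussianReal fun L => ?_⟩⟩
    have hI : Measurable (fun ω => I.restrict (fun t => B ω t)) :=
      (Finset.measurable_restrict I).comp hB
    rw [Measure.map_map (by fun_prop) hI]
    let e := I.equivFin
    refine ⟨0, _, Eq.trans ?_ (h I.card (fun i => L (fun j => if e.symm i = j then 1 else 0))
      (fun i => (e.symm i : ℝ≥0)))⟩
    congr 1
    ext ω
    have hs := L.toLinearMap.pi_apply_eq_sum_univ (I.restrict (fun t => B ω t))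
    simp only [ContinuousLinearMap.coe_coe] at hs
    rw [Function.comp_apply, hs, ← Equiv.sum_comp e.symm]
    refine Finset.sum_congr rfl fun i _ => ?_
    rw [smul_eq_mul, mul_comm]
    rfl
  have h1 : ∀ t, P.map (fun ω => B ω t) = gaussianReal 0 t := by
    intro t
    have := h 1 (fun _ => 1) (fun _ => t)
    simpa using this
  have hL : ∀ t, MemLp (fun ω => B ω t) 2 P := fun t => (hG.hasGaussianLaw_eval t).memLp_two
  have hv : ∀ t, Var[fun ω => B ω t; P] = t := by
    intro t
    have : HasLaw (fun ω => B ω t) (gaussianReal 0 t) P := ⟨(hm t).aemeasurable, h1 t⟩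
    rw [this.variance_eq, variance_id_gaussianReal]
  refine hG.isPreBrownianReal_of_covariance (fun t => ?_) (fun s t hst => ?_)
  · have : HasLaw (fun ω => B ω t) (gaussianReal 0 t) P := ⟨(hm t).aemeasurable, h1 t⟩
    rw [this.integral_eq, integral_id_gaussianReal]
  · have h2 := h 2 (fun _ => 1) ![s, t]
    have : HasLaw (fun ω => B ω s + B ω t) (gaussianReal 0 (s + s + s + t)) P := by
      refine ⟨((hm s).add (hm t)).aemeasurable, ?_⟩
      have hst' : (s : ℝ) ≤ t := hst
      simp only [Fin.sum_univ_two, one_mul, Matrix.cons_val_zero, Matrix.cons_val_one, min_self,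
        min_eq_left hst', min_eq_right hst'] at h2
      rw [h2]
      congr 1
      rw [← NNReal.coe_inj, Real.coe_toNNReal _ (by positivity)]
      push_cast; ring
    have h3 := this.variance_eq
    rw [variance_id_gaussianReal] at h3
    have h4 := variance_fun_add (hL s) (hL t)
    rw [h3, hv, hv] at h4
    push_cast at h4
    linarith

/-- Brownian motion reaches level one almost surely. -/
theorem ae_exists_ge_one {Ω : Type*} [MeasurableSpace Ω] {P : Measure Ω} [IsProbabilityMeasure P]
    {X : ℝ≥0 → Ω → ℝ} (hm : ∀ t, Measurable (X t)) (hX : IsPreBrownianReal X P) :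
    ∀ᵐ ω ∂P, ∃ t, 1 ≤ X t ω := by
  let f : ℕ → ℝ≥0 → ℝ≥0 := fun k x => x + (1 + 2 ^ k * NNReal.sqrt x) ^ 2
  let t : ℕ → ℝ≥0 := fun k => Nat.rec 1 f k
  have ht : ∀ k, t (k + 1) = t k + (1 + 2 ^ k * NNReal.sqrt (t k)) ^ 2 := fun k => rfl
  have htm : Monotone t := monotone_nat_of_le_succ fun k => by rw [ht]; exact le_self_add
  have htp : ∀ k, 0 < t k := fun k => lt_of_lt_of_le one_pos (htm (Nat.zero_le k))
  let M : ℕ → ℝ≥0 := fun k => 2 ^ k * NNReal.sqrt (t k)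
  have hMp : ∀ k, 0 < M k := fun k => by
    have : 0 < NNReal.sqrt (t k) := NNReal.sqrt_pos.2 (htp k)
    positivity
  -- first Borel-Cantelli
  have hA : ∀ᵐ ω ∂P, ∀ᶠ k in atTop, ω ∉ {ω | (M k : ℝ) ≤ |X (t k) ω|} := by
    apply ae_eventually_notMem
    have hle : ∀ k, P {ω | (M k : ℝ) ≤ |X (t k) ω|} ≤ ENNReal.ofReal ((1 / 4 : ℝ) ^ k) := by
      intro k
      have := meas_ge_le_variance_div_sq (μ := P) (X := X (t k))
        (hX.isGaussianProcess.hasGaussianLaw_eval _).memLp_two (c := M k) (hMp k)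
      rw [hX.integral_eval, (hX.hasLaw_eval (t k)).variance_eq, variance_id_gaussianReal] at this
      simp only [sub_zero] at this
      refine this.trans (ENNReal.ofReal_le_ofReal (le_of_eq ?_))
      have h1 : ((M k : ℝ)) ^ 2 = 4 ^ k * NNReal.toReal (t k) := by
        have : M k ^ 2 = 4 ^ k * t k := by
          simp only [M, mul_pow, NNReal.sq_sqrt]
          rw [← pow_mul, mul_comm k, pow_mul]; norm_num
        exact_mod_cast this
      have h2 : 0 < NNReal.toReal (t k) := NNReal.coe_pos.2 (htp k)
      rw [h1, div_pow, one_pow]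
      field_simp
    refine ne_of_lt (lt_of_le_of_lt (ENNReal.tsum_le_tsum hle) ?_)
    rw [← ENNReal.ofReal_tsum_of_nonneg (fun _ => by positivity)
      (summable_geometric_of_lt_one (by norm_num) (by norm_num))]
    exact ENNReal.ofReal_lt_top
  -- second Borel-Cantelli
  let D : ℕ → Ω → ℝ := fun k ω => X (t (k + 1)) ω - X (t k) ω
  have hDm : ∀ k, Measurable (D k) := fun k => (hm _).sub (hm _)
  have hI : iIndepFun D P := hX.hasIndepIncrements.nat htm
  have hlaw : ∀ k, P {ω | (1 + M k : ℝ) < D k ω} = gaussianReal 0 1 (Ioi 1) := by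
    intro k
    have h1 := (hX.hasLaw_sub (t (k + 1)) (t k)).map_eq
    have h2 : nndist (t (k + 1)).1 (t k).1 = (1 + M k) ^ 2 := by
      rw [ht]
      rw [← NNReal.coe_inj, coe_nndist, Real.dist_eq]
      simp only [M]
      rw [abs_of_nonneg] <;> simp <;> positivity
    have h3 := gaussianReal_map_const_mul (μ := 0) (v := 1) (1 + M k : ℝ)
    have h4 : P.map (D k) = (gaussianReal 0 1).map ((1 + M k : ℝ) * ·) := by
      rw [h3]
      refine h1.trans ?_
      rw [h2]
      congr 1
      · simp
      · rw [← NNReal.coe_inj]; simp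
    have h5 : P.map (D k) (Ioi (1 + M k : ℝ)) = P {ω | (1 + M k : ℝ) < D k ω} :=
      Measure.map_apply (hDm k) measurableSet_Ioi
    rw [← h5, h4, Measure.map_apply (by fun_prop) measurableSet_Ioi]
    congr 1
    ext x
    have : (0 : ℝ) < 1 + M k := by positivity
    simp [this, div_self this.ne']
  have hpos : gaussianReal 0 1 (Ioi 1) ≠ 0 := by
    intro h
    have := (gaussianReal_absolutelyContinuous' 0 (one_ne_zero (α := ℝ≥0))) h
    simp at this
  have hIS : iIndepSet (fun k => {ω | (1 + M k : ℝ) < D k ω}) P := by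
    refine (iIndepSet_iff_meas_biInter (fun k => (hDm k) measurableSet_Ioi)).2 fun s => ?_
    exact hI.measure_inter_preimage_eq_mul s (fun i _ => measurableSet_Ioi)
  have hC := measure_limsup_eq_one (fun k => (hDm k) measurableSet_Ioi) hIS (by
    refine (tsum_congr hlaw).trans ?_
    exact ENNReal.tsum_const_eq_top_of_ne_zero hpos)
  have hC' : ∀ᵐ ω ∂P, ω ∈ limsup (fun k => {ω | (1 + M k : ℝ) < D k ω}) atTop :=
    (mem_ae_iff_prob_eq_one (MeasurableSet.measurableSet_limsup
      fun k => (hDm k) measurableSet_Ioi)).2 hC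
  filter_upwards [hA, hC'] with ω h1 h2
  rw [mem_limsup_iff_frequently_mem] at h2
  obtain ⟨k, hk, hk'⟩ := (h2.and_eventually h1).exists
  refine ⟨t (k + 1), ?_⟩
  simp only [mem_ofPred_eq, not_le, D] at hk hk'
  have := (abs_lt.1 hk').1
  linarith

theorem sInf_le_of_agree {S S' : Set ℝ≥0} {t₀ : ℝ≥0} (h : ∀ x < t₀, x ∈ S ↔ x ∈ S')
    (h0 : 0 < sInf S) (h1 : sInf S < t₀) : sInf S' ≤ sInf S := by
  have hne : S.Nonempty := by
    by_contra hh
    rw [Set.not_nonempty_iff_eq_empty] at hh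
    simp [hh] at h0
  obtain ⟨s, hs, hst⟩ := exists_lt_of_csInf_lt hne h1
  refine le_csInf hne fun x hx => ?_
  rcases lt_or_ge x t₀ with hxt | hxt
  · exact csInf_le (OrderBot.bddBelow _) ((h x hxt).1 hx)
  · exact (csInf_le (OrderBot.bddBelow _) ((h s hst).1 hs)).trans (hst.le.trans hxt)

theorem sInf_eq_of_agree {S S' : Set ℝ≥0} {t₀ : ℝ≥0} (h : ∀ x < t₀, x ∈ S ↔ x ∈ S')
    (h0 : 0 < sInf S) (h1 : sInf S < t₀) : sInf S' = sInf S := by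
  have hne : S.Nonempty := by
    by_contra hh
    rw [Set.not_nonempty_iff_eq_empty] at hh
    simp [hh] at h0
  obtain ⟨s, hs, hst⟩ := exists_lt_of_csInf_lt hne h1
  have hs' : s ∈ S' := (h s hst).1 hs
  refine le_antisymm (sInf_le_of_agree h h0 h1) (le_csInf ⟨s, hs'⟩ fun x hx => ?_)
  rcases lt_or_ge x t₀ with hxt | hxt
  · exact csInf_le (OrderBot.bddBelow _) ((h x hxt).2 hx)
  · exact (csInf_le (OrderBot.bddBelow _) hs).trans (hst.le.trans hxt)

/-- The path stopped at time `t₀`. -/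
def stopPath (f : ℝ≥0 → ℝ) (t₀ : ℝ≥0) : ℝ≥0 → ℝ := fun t => f (min t t₀)

theorem stopPath_agree (f : ℝ≥0 → ℝ) (t₀ : ℝ≥0) :
    ∀ x < t₀, x ∈ {t : ℝ≥0 | f t = 1} ↔ x ∈ {t : ℝ≥0 | stopPath f t₀ t = 1} := by
  intro x hx
  simp [stopPath, min_eq_left hx.le]

theorem hitOne_stopPath {f : ℝ≥0 → ℝ} {t₀ : ℝ≥0} (h0 : 0 < hitOne f) (h1 : hitOne f < t₀) :
    hitOne (stopPath f t₀) = hitOne f :=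
  sInf_eq_of_agree (stopPath_agree f t₀) h0 h1

theorem hitOne_stopPath' {f : ℝ≥0 → ℝ} {t₀ : ℝ≥0} (h0 : 0 < hitOne (stopPath f t₀))
    (h1 : hitOne (stopPath f t₀) < t₀) :
    hitOne f = hitOne (stopPath f t₀) :=
  sInf_eq_of_agree (fun x hx => (stopPath_agree f t₀ x hx).symm) h0 h1

theorem coAscent_stopPath {f : ℝ≥0 → ℝ} {t₀ : ℝ≥0} (h0 : 0 < hitOne f) (h1 : hitOne f < t₀)
    {s : ℝ≥0} (hs : s ≤ 1) : brownianCoAscent (stopPath f t₀) s = brownianCoAscent f s := by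
  unfold brownianCoAscent
  rw [hitOne_stopPath h0 h1]
  unfold stopPath
  rw [min_eq_left]
  exact (mul_le_of_le_one_right zero_le hs).trans h1.le

theorem exists_hit_iff {f : ℝ≥0 → ℝ} (hf : Continuous f) (h0 : f 0 = 0) (t : ℝ≥0)
    {D : Set (Iic t)} (hD : Dense D) :
    (∃ s ≤ t, f s = 1) ↔ ∀ n : ℕ, ∃ s ∈ D, 1 - 1 / ((n : ℝ) + 1) < f s := by
  constructor
  · rintro ⟨s, hs, hfs⟩ n
    have ho : IsOpen {x : Iic t | 1 - 1 / ((n : ℝ) + 1) < f x} :=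
      isOpen_lt continuous_const (hf.comp continuous_subtype_val)
    obtain ⟨x, hx, hxD⟩ := hD.inter_open_nonempty _ ho ⟨⟨s, hs⟩, by
      have : (0 : ℝ) < 1 / ((n : ℝ) + 1) := by positivity
      simp only [mem_ofPred_eq, hfs]; linarith⟩
    exact ⟨x, hxD, hx⟩
  · intro h
    have hc : IsCompact (Iic t) := by
      rw [← Icc_bot]; exact isCompact_Icc
    obtain ⟨x, hx, hmax⟩ := hc.exists_isMaxOn ⟨t, self_mem_Iic⟩ hf.continuousOn
    have h1 : 1 ≤ f x := by
      have hlim : Tendsto (fun n : ℕ => 1 - 1 / ((n : ℝ) + 1)) atTop (nhds (1 - 0)) :=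
        tendsto_const_nhds.sub tendsto_one_div_add_atTop_nhds_zero_nat
      rw [sub_zero] at hlim
      refine le_of_tendsto hlim (Eventually.of_forall fun n => ?_)
      obtain ⟨s, -, hs⟩ := h n
      exact hs.le.trans (hmax s.2)
    obtain ⟨s, hs, hfs⟩ := intermediate_value_Icc (zero_le : (0 : ℝ≥0) ≤ x) hf.continuousOn
      (show (1 : ℝ) ∈ Icc (f 0) (f x) by rw [h0]; exact ⟨zero_le_one, h1⟩)
    exact ⟨s, hs.2.trans hx, hfs⟩

theorem hitOne_mem {f : ℝ≥0 → ℝ} (hf : Continuous f) (h : ∃ s, f s = 1) : f (hitOne f) = 1 :=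
  IsClosed.csInf_mem (s := {t : ℝ≥0 | f t = 1}) (isClosed_eq hf continuous_const) h
    (OrderBot.bddBelow _)

theorem hitOne_le_iff {f : ℝ≥0 → ℝ} (hf : Continuous f) (t : ℝ≥0) :
    hitOne f ≤ t ↔ (∃ s ≤ t, f s = 1) ∨ ∀ n : ℕ, ¬ ∃ s ≤ (n : ℝ≥0), f s = 1 := by
  constructor
  · intro h
    by_cases hh : ∃ s, f s = 1
    · exact Or.inl ⟨_, h, hitOne_mem hf hh⟩
    · exact Or.inr fun n ⟨s, _, hs⟩ => hh ⟨s, hs⟩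
  · rintro (⟨s, hs, hfs⟩ | h)
    · exact (csInf_le (s := {t : ℝ≥0 | f t = 1}) (OrderBot.bddBelow _) hfs).trans hs
    · have : {t : ℝ≥0 | f t = 1} = ∅ := by
        ext s
        simp only [mem_ofPred_eq, mem_empty_iff_false, iff_false]
        intro hs
        obtain ⟨n, hn⟩ := exists_nat_ge s
        exact h n ⟨s, hn, hs⟩
      simp [hitOne, this]

theorem measurable_hitOne {Ω : Type*} {m : MeasurableSpace Ω} {Z : Ω → ℝ≥0 → ℝ}
    (hc : ∀ ω, Continuous (Z ω)) (h0 : ∀ ω, Z ω 0 = 0) (hm : ∀ t, Measurable (fun ω => Z ω t)) :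
    Measurable (fun ω => hitOne (Z ω)) := by
  have key : ∀ t : ℝ≥0, MeasurableSet {ω | ∃ s ≤ t, Z ω s = 1} := by
    intro t
    obtain ⟨D, hDc, hD⟩ := TopologicalSpace.exists_countable_dense (Iic t)
    have : {ω | ∃ s ≤ t, Z ω s = 1} =
        ⋂ n : ℕ, ⋃ s ∈ D, {ω | 1 - 1 / ((n : ℝ) + 1) < Z ω s} := by
      ext ω
      have := exists_hit_iff (hc ω) (h0 ω) t hD
      simp only [mem_ofPred_eq, this, mem_iInter, mem_iUnion, exists_prop]
    rw [this]
    exact MeasurableSet.iInter fun n => MeasurableSet.biUnion hDc fun s _ =>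
      measurableSet_lt measurable_const (hm s)
  refine measurable_of_Iic fun t => ?_
  have : (fun ω => hitOne (Z ω)) ⁻¹' Iic t =
      {ω | ∃ s ≤ t, Z ω s = 1} ∪ ⋂ n : ℕ, {ω | ∃ s ≤ (n : ℝ≥0), Z ω s = 1}ᶜ := by
    ext ω
    simp only [mem_preimage, mem_Iic, hitOne_le_iff (hc ω) t, mem_union, mem_iInter, mem_compl_iff,
      mem_ofPred_eq]
  rw [this]
  exact (key t).union (MeasurableSet.iInter fun n => (key n).compl)

theorem measurable_eval_path {Ω : Type*} {m : MeasurableSpace Ω} {Z : Ω → ℝ≥0 → ℝ}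
    (hc : ∀ ω, Continuous (Z ω)) (hm : ∀ t, Measurable (fun ω => Z ω t))
    {τ : Ω → ℝ≥0} (hτ : Measurable τ) : Measurable (fun ω => Z ω (τ ω)) := by
  have h := measurable_uncurry_of_continuous_of_measurable (u := fun t ω => Z ω t) hc hm
  exact h.comp (hτ.prodMk measurable_id)

theorem measurable_coAscent {Ω : Type*} {m : MeasurableSpace Ω} {Z : Ω → ℝ≥0 → ℝ}
    (hc : ∀ ω, Continuous (Z ω)) (h0 : ∀ ω, Z ω 0 = 0) (hm : ∀ t, Measurable (fun ω => Z ω t))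
    (s : ℝ≥0) : Measurable (fun ω => brownianCoAscent (Z ω) s) := by
  have hT := measurable_hitOne hc h0 hm
  unfold brownianCoAscent
  exact (hT.coe_nnreal_real.pow_const _).mul (measurable_eval_path hc hm (hT.mul_const s))

/-- Rescaled increment process after time `r`. -/
def postInc (f : ℝ≥0 → ℝ) (r s : ℝ≥0) : ℝ :=
  (r : ℝ) ^ (-(1 / 2 : ℝ)) * f (r * (1 + s)) - (r : ℝ) ^ (-(1 / 2 : ℝ)) * f (r * 1)

theorem postInc_eq (f : ℝ≥0 → ℝ) (r s : ℝ≥0) :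
    postInc f r s = (√(r : ℝ))⁻¹ * (f (r + r * s) - f r) := by
  unfold postInc
  rw [Real.rpow_neg (NNReal.coe_nonneg r), ← Real.sqrt_eq_rpow, mul_one, mul_add, mul_one]
  ring

section good

variable {Ω : Type*} [MeasurableSpace Ω] {P : Measure Ω}
  {Z : Ω → ℝ≥0 → ℝ}

theorem postInc_pre (hZ : IsPreBrownianReal (fun t ω => Z ω t) P) {r : ℝ≥0} (hr : r ≠ 0) :
    IsPreBrownianReal (fun s ω => postInc (Z ω) r s) P := by
  have := (hZ.shift r).smul hr
  simpa only [postInc_eq] using this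

theorem postInc_indep (hZ : IsPreBrownianReal (fun t ω => Z ω t) P) (r : ℝ≥0) :
    IndepFun (fun ω s => postInc (Z ω) r s) (fun ω (t : Set.Iic r) => Z ω t) P := by
  have h := hZ.indepFun_shift r
  have h2 := h.comp (φ := fun (g : ℝ≥0 → ℝ) (s : ℝ≥0) => (√(r : ℝ))⁻¹ * g (r * s))
    (measurable_pi_lambda _ fun s => (measurable_pi_apply _).const_mul _) measurable_id
  simp only [postInc_eq]
  exact h2

theorem measure_eq_tsum_fibers {κ : Ω → ℕ} (hκ : Measurable κ) {S : Set Ω} (hS : MeasurableSet S) :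
    P S = ∑' k, P (S ∩ κ ⁻¹' {k}) := by
  rw [← measure_iUnion]
  · congr 1
    ext ω
    simp
  · intro i j hij
    refine Set.disjoint_left.2 fun ω h1 h2 => hij ?_
    have h1' : κ ω = i := h1.2
    have h2' : κ ω = j := h2.2
    rw [← h1', h2']
  · exact fun k => hS.inter (hκ (measurableSet_singleton k))

/-- Dyadic-type approximation of the hitting time from above. -/
def hitApprox (n : ℕ) (x : ℝ≥0) : ℝ≥0 := ((⌊((n : ℝ≥0) + 1) * x⌋₊ : ℝ≥0) + 1) / ((n : ℝ≥0) + 1)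

theorem lt_hitApprox (n : ℕ) (x : ℝ≥0) : x < hitApprox n x := by
  unfold hitApprox
  rw [lt_div_iff₀ (by positivity), mul_comm]
  exact Nat.lt_floor_add_one _

theorem hitApprox_le (n : ℕ) (x : ℝ≥0) : hitApprox n x ≤ x + 1 / ((n : ℝ≥0) + 1) := by
  unfold hitApprox
  have hp : (0 : ℝ≥0) < (n : ℝ≥0) + 1 := by positivity
  have h1 : (x + 1 / ((n : ℝ≥0) + 1)) * ((n : ℝ≥0) + 1) = ((n : ℝ≥0) + 1) * x + 1 := by
    field_simp
  rw [div_le_iff₀ hp, h1]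
  gcongr
  exact Nat.floor_le zero_le

theorem tendsto_hitApprox (x : ℝ≥0) : Tendsto (fun n => hitApprox n x) atTop (nhds x) := by
  refine tendsto_of_tendsto_of_tendsto_of_le_of_le (h := fun n : ℕ => x + 1 / ((n : ℝ≥0) + 1))
    tendsto_const_nhds ?_ (fun n => (lt_hitApprox n x).le) (fun n => hitApprox_le n x)
  have : Tendsto (fun n : ℕ => x + 1 / ((n : ℝ≥0) + 1)) atTop (nhds (x + 0)) :=
    tendsto_const_nhds.add tendsto_one_div_add_atTop_nhds_zero_nat
  rwa [add_zero] at this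

/-- The discretised strong Markov property, with rescaling. -/
theorem discrete_markov [IsProbabilityMeasure P] (hc : ∀ ω, Continuous (Z ω)) (h0 : ∀ ω, Z ω 0 = 0)
    (hm : ∀ t, Measurable (fun ω => Z ω t)) (hZ : IsPreBrownianReal (fun t ω => Z ω t) P)
    (hpos : ∀ᵐ ω ∂P, 0 < hitOne (Z ω)) (n : ℕ) (I : Finset ℝ≥0)
    {E : Set (Set.Icc (0 : ℝ≥0) 1 → ℝ)} (hE : MeasurableSet E)
    {A : Set (I → ℝ)} (hA : MeasurableSet A) :
    P ({ω | (fun s : Set.Icc (0 : ℝ≥0) 1 => brownianCoAscent (Z ω) s) ∈ E} ∩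
      {ω | I.restrict (postInc (Z ω) (hitApprox n (hitOne (Z ω)))) ∈ A}) =
    P {ω | (fun s : Set.Icc (0 : ℝ≥0) 1 => brownianCoAscent (Z ω) s) ∈ E} *
      P.map (fun ω => I.restrict (Z ω)) A := by
  have hT := measurable_hitOne hc h0 hm
  have hfl : Measurable (fun x : ℝ≥0 => ⌊((n : ℝ≥0) + 1) * x⌋₊) :=
    Nat.measurable_floor.comp (measurable_const.mul measurable_id)
  set κ : Ω → ℕ := fun ω => ⌊((n : ℝ≥0) + 1) * hitOne (Z ω)⌋₊ with hκdef
  have hκ : Measurable κ := hfl.comp hT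
  have hTn : Measurable (fun ω => hitApprox n (hitOne (Z ω))) := by
    have : Measurable (fun k : ℕ => ((k : ℝ≥0) + 1) / ((n : ℝ≥0) + 1)) := measurable_of_countable _
    exact this.comp hκ
  have hY : Measurable (fun ω => fun s : Set.Icc (0 : ℝ≥0) 1 => brownianCoAscent (Z ω) s) :=
    measurable_pi_lambda _ fun s => measurable_coAscent hc h0 hm s
  have hX : ∀ τ : Ω → ℝ≥0, Measurable τ →
      Measurable (fun ω => I.restrict (postInc (Z ω) (τ ω))) := by
    intro τ hτ
    refine measurable_pi_lambda _ fun s => ?_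
    simp only [Finset.restrict_def, postInc]
    exact ((hτ.coe_nnreal_real.pow_const _).mul (measurable_eval_path hc hm (hτ.mul_const _))).sub
      ((hτ.coe_nnreal_real.pow_const _).mul (measurable_eval_path hc hm (hτ.mul_const _)))
  set FE := {ω | (fun s : Set.Icc (0 : ℝ≥0) 1 => brownianCoAscent (Z ω) s) ∈ E} with hFE
  have hFEm : MeasurableSet FE := hY hE
  set F := {ω | 0 < hitOne (Z ω)} ∩ FE with hF
  have hFm : MeasurableSet F := (measurableSet_lt measurable_const hT).inter hFEm
  have hFF : F =ᵐ[P] FE := by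
    filter_upwards [hpos] with ω hω
    apply propext
    exact ⟨fun h => h.2, fun h => ⟨hω, h⟩⟩
  have hFF' : (F ∩ {ω | I.restrict (postInc (Z ω) (hitApprox n (hitOne (Z ω)))) ∈ A} : Set Ω)
      =ᵐ[P] (FE ∩ {ω | I.restrict (postInc (Z ω) (hitApprox n (hitOne (Z ω)))) ∈ A} : Set Ω) :=
    hFF.inter (ae_eq_refl _)
  rw [← measure_congr hFF, ← measure_congr hFF']
  have hSm : MeasurableSet
      (F ∩ {ω | I.restrict (postInc (Z ω) (hitApprox n (hitOne (Z ω)))) ∈ A}) :=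
    hFm.inter (hX _ hTn hA)
  rw [measure_eq_tsum_fibers hκ hSm, measure_eq_tsum_fibers hκ hFm,
    ← ENNReal.tsum_mul_right]
  refine tsum_congr fun k => ?_
  let r : ℝ≥0 := ((k : ℝ≥0) + 1) / ((n : ℝ≥0) + 1)
  have hr : r ≠ 0 := by positivity
  have e1 : F ∩ {ω | I.restrict (postInc (Z ω) (hitApprox n (hitOne (Z ω)))) ∈ A} ∩ κ ⁻¹' {k} =
      {ω | I.restrict (postInc (Z ω) r) ∈ A} ∩ (F ∩ κ ⁻¹' {k}) := by
    have hk : ∀ ω, κ ω = k → hitApprox n (hitOne (Z ω)) = r := by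
      intro ω h
      simp only [hκdef] at h
      simp only [hitApprox, h, r]
    ext ω
    simp only [mem_inter_iff, mem_ofPred_eq, mem_preimage, mem_singleton_iff]
    constructor
    · rintro ⟨⟨h1, h2⟩, h3⟩
      rw [hk ω h3] at h2
      exact ⟨h2, h1, h3⟩
    · rintro ⟨h2, h1, h3⟩
      refine ⟨⟨h1, ?_⟩, h3⟩
      rw [hk ω h3]; exact h2
  have e2 : MeasurableSet[MeasurableSpace.comap (fun ω (t : Set.Iic r) => Z ω t) inferInstance]
      (F ∩ κ ⁻¹' {k}) := by
    let m : MeasurableSpace Ω :=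
      MeasurableSpace.comap (fun ω (t : Set.Iic r) => Z ω t) inferInstance
    have hmm : ∀ t, Measurable[m] (fun ω => stopPath (Z ω) r t) := fun t =>
      (measurable_pi_apply (⟨min t r, mem_Iic.2 (min_le_right t r)⟩ : Set.Iic r)).comp
        (comap_measurable (fun ω (t : Set.Iic r) => Z ω t))
    have hcc : ∀ ω, Continuous (stopPath (Z ω) r) := fun ω =>
      (hc ω).comp (continuous_id.min continuous_const)
    have h00 : ∀ ω, stopPath (Z ω) r 0 = 0 := fun ω => by simp [stopPath, h0]
    have mT : Measurable[m] (fun ω => hitOne (stopPath (Z ω) r)) :=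
      measurable_hitOne hcc h00 hmm
    have mY : Measurable[m]
        (fun ω => fun s : Set.Icc (0 : ℝ≥0) 1 => brownianCoAscent (stopPath (Z ω) r) s) :=
      @measurable_pi_lambda _ _ _ m _ _ fun s => measurable_coAscent hcc h00 hmm s
    have hlt : ∀ x : ℝ≥0, ⌊((n : ℝ≥0) + 1) * x⌋₊ = k → x < r := by
      intro x hx
      have := lt_hitApprox n x
      simpa only [hitApprox, hx] using this
    have e3 : F ∩ κ ⁻¹' {k} = (fun ω => hitOne (stopPath (Z ω) r)) ⁻¹' (Ioi 0) ∩
        (fun ω => fun s : Set.Icc (0 : ℝ≥0) 1 => brownianCoAscent (stopPath (Z ω) r) s) ⁻¹' E ∩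
        (fun ω => hitOne (stopPath (Z ω) r)) ⁻¹'
          ((fun x : ℝ≥0 => ⌊((n : ℝ≥0) + 1) * x⌋₊) ⁻¹' {k}) := by
      ext ω
      have hyy : 0 < hitOne (Z ω) → hitOne (Z ω) < r →
          (fun s : Set.Icc (0 : ℝ≥0) 1 => brownianCoAscent (stopPath (Z ω) r) s) =
          (fun s : Set.Icc (0 : ℝ≥0) 1 => brownianCoAscent (Z ω) s) := fun h1 h2 =>
        funext fun s => coAscent_stopPath h1 h2 s.2.2
      simp only [hF, hFE, hκdef, mem_inter_iff, mem_ofPred_eq, mem_preimage, mem_singleton_iff,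
        mem_Ioi]
      constructor
      · rintro ⟨⟨h1, h2⟩, h3⟩
        have h4 := hlt _ h3
        rw [hitOne_stopPath h1 h4, hyy h1 h4]
        exact ⟨⟨h1, h2⟩, h3⟩
      · rintro ⟨⟨h1, h2⟩, h3⟩
        have h4 := hlt _ h3
        have h5 := hitOne_stopPath' h1 h4
        rw [← h5] at h1 h3 h4
        rw [hyy h1 h4] at h2
        exact ⟨⟨h1, h2⟩, h3⟩
    rw [e3]
    exact ((mT measurableSet_Ioi).inter (mY hE)).inter (mT (hfl (measurableSet_singleton k)))
  obtain ⟨G, hG, hGe⟩ := e2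
  rw [e1, ← hGe]
  have hA' : MeasurableSet (I.restrict ⁻¹' A : Set (ℝ≥0 → ℝ)) := Finset.measurable_restrict I hA
  have h := (postInc_indep hZ r).measure_inter_preimage_eq_mul _ _ hA' hG
  refine h.trans ?_
  rw [mul_comm]
  congr 1
  have h1 := ((postInc_pre hZ hr).hasLaw I).map_eq
  have h2 := (hZ.hasLaw I).map_eq
  have h3 : P.map (fun ω => I.restrict (Z ω)) = P.map (fun ω => I.restrict (postInc (Z ω) r)) :=
    h2.trans h1.symm
  rw [h3, Measure.map_apply (hX _ measurable_const) hA]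
  rfl

/-- The strong Markov property with rescaling. -/
theorem full_markov [IsProbabilityMeasure P] (hc : ∀ ω, Continuous (Z ω)) (h0 : ∀ ω, Z ω 0 = 0)
    (hm : ∀ t, Measurable (fun ω => Z ω t)) (hZ : IsPreBrownianReal (fun t ω => Z ω t) P)
    (hpos : ∀ᵐ ω ∂P, 0 < hitOne (Z ω)) (I : Finset ℝ≥0)
    {E : Set (Set.Icc (0 : ℝ≥0) 1 → ℝ)} (hE : MeasurableSet E)
    {A : Set (I → ℝ)} (hA : MeasurableSet A) :
    P ({ω | (fun s : Set.Icc (0 : ℝ≥0) 1 => brownianCoAscent (Z ω) s) ∈ E} ∩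
      {ω | I.restrict (postInc (Z ω) (hitOne (Z ω))) ∈ A}) =
    P {ω | (fun s : Set.Icc (0 : ℝ≥0) 1 => brownianCoAscent (Z ω) s) ∈ E} *
      P.map (fun ω => I.restrict (Z ω)) A := by
  have hT := measurable_hitOne hc h0 hm
  have hTn : ∀ n, Measurable (fun ω => hitApprox n (hitOne (Z ω))) := by
    intro n
    have hfl : Measurable (fun x : ℝ≥0 => ⌊((n : ℝ≥0) + 1) * x⌋₊) :=
      Nat.measurable_floor.comp (measurable_const.mul measurable_id)
    have : Measurable (fun k : ℕ => ((k : ℝ≥0) + 1) / ((n : ℝ≥0) + 1)) := measurable_of_countable _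
    exact this.comp (hfl.comp hT)
  have hY : Measurable (fun ω => fun s : Set.Icc (0 : ℝ≥0) 1 => brownianCoAscent (Z ω) s) :=
    measurable_pi_lambda _ fun s => measurable_coAscent hc h0 hm s
  have hX : ∀ τ : Ω → ℝ≥0, Measurable τ →
      Measurable (fun ω => I.restrict (postInc (Z ω) (τ ω))) := by
    intro τ hτ
    refine measurable_pi_lambda _ fun s => ?_
    simp only [Finset.restrict_def, postInc]
    exact ((hτ.coe_nnreal_real.pow_const _).mul (measurable_eval_path hc hm (hτ.mul_const _))).sub
      ((hτ.coe_nnreal_real.pow_const _).mul (measurable_eval_path hc hm (hτ.mul_const _)))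
  have hZI : Measurable (fun ω => I.restrict (Z ω)) := measurable_pi_lambda _ fun s => hm s
  set F := {ω | (fun s : Set.Icc (0 : ℝ≥0) 1 => brownianCoAscent (Z ω) s) ∈ E} with hF
  have hFm : MeasurableSet F := hY hE
  have hn : ∀ n, (P.restrict F).map
      (fun ω => I.restrict (postInc (Z ω) (hitApprox n (hitOne (Z ω))))) =
      P F • P.map (fun ω => I.restrict (Z ω)) := by
    intro n
    ext A hA
    rw [Measure.map_apply (hX _ (hTn n)) hA, Measure.restrict_apply (hX _ (hTn n) hA), inter_comm]
    exact discrete_markov hc h0 hm hZ hpos n I hE hA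
  have : IsFiniteMeasure (P F • P.map (fun ω => I.restrict (Z ω))) := by
    rw [← hn 0]; infer_instance
  have hlim : (P.restrict F).map (fun ω => I.restrict (postInc (Z ω) (hitOne (Z ω)))) =
      P F • P.map (fun ω => I.restrict (Z ω)) := by
    refine ext_of_forall_integral_eq_of_IsFiniteMeasure fun f => ?_
    have hfn : ∀ n, ∫ ω, f (I.restrict (postInc (Z ω) (hitApprox n (hitOne (Z ω))))) ∂(P.restrict F)
        = ∫ x, f x ∂(P F • P.map (fun ω => I.restrict (Z ω))) := by
      intro n
      rw [← hn n, integral_map (hX _ (hTn n)).aemeasurable f.continuous.aestronglyMeasurable]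
    rw [integral_map (hX _ hT).aemeasurable f.continuous.aestronglyMeasurable]
    have hconv : Tendsto (fun n => ∫ ω,
        f (I.restrict (postInc (Z ω) (hitApprox n (hitOne (Z ω))))) ∂(P.restrict F)) atTop
        (nhds (∫ ω, f (I.restrict (postInc (Z ω) (hitOne (Z ω)))) ∂(P.restrict F))) := by
      refine tendsto_integral_of_dominated_convergence (fun _ => ‖f‖)
        (fun n => (f.continuous.measurable.comp (hX _ (hTn n))).aestronglyMeasurable)
        (integrable_const _) (fun n => ae_of_all _ fun ω => f.norm_coe_le_norm _) ?_
      filter_upwards [ae_restrict_of_ae hpos] with ω hω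
      refine (f.continuous.tendsto _).comp ?_
      refine tendsto_pi_nhds.2 fun s => ?_
      have hca : ContinuousAt (fun r : ℝ≥0 => postInc (Z ω) r s) (hitOne (Z ω)) := by
        unfold postInc
        have h1 : ContinuousAt (fun r : ℝ≥0 => (r : ℝ) ^ (-(1 / 2 : ℝ))) (hitOne (Z ω)) :=
          ContinuousAt.rpow_const NNReal.continuous_coe.continuousAt
            (Or.inl (NNReal.coe_ne_zero.2 hω.ne'))
        exact (h1.mul ((hc ω).comp (continuous_id.mul continuous_const)).continuousAt).sub
          (h1.mul ((hc ω).comp (continuous_id.mul continuous_const)).continuousAt)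
      exact hca.tendsto.comp (tendsto_hitApprox _)
    simp_rw [hfn] at hconv
    exact tendsto_nhds_unique hconv tendsto_const_nhds
  have := congrArg (fun μ => μ A) hlim
  rw [Measure.map_apply (hX _ hT) hA, Measure.restrict_apply (hX _ hT hA), inter_comm] at this
  exact this

end good
/-- the post-`1` increment process `(B^a_{1+s} - B^a_1)_{s≥0}` of the extended
Brownian co-ascent is again a standard Brownian motion, independent of `(B^a_s)_{0≤s≤1}`. -/
theorem statement18 {Ω : Type*} [MeasurableSpace Ω] (P : Measure Ω) [IsProbabilityMeasure P]
    (B : Ω → ℝ≥0 → ℝ) (hB : Measurable B) (hBM : IsStdBrownian P B) :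
    IsStdBrownian P
      (fun ω s => brownianCoAscent (B ω) (1 + s) - brownianCoAscent (B ω) 1) ∧
    IndepFun
      (fun ω => fun s : ℝ≥0 => brownianCoAscent (B ω) (1 + s) - brownianCoAscent (B ω) 1)
      (fun ω => fun s : Set.Icc (0 : ℝ≥0) 1 => brownianCoAscent (B ω) s) P := by
  have hpreB := hBM.pre hB
  have hBm : ∀ t, Measurable (fun ω => B ω t) := fun t => (measurable_pi_apply t).comp hB
  obtain ⟨hcont, hzero, hlin⟩ := hBM
  have hgood : ∀ᵐ ω ∂P, Continuous (B ω) ∧ B ω 0 = 0 := hcont.and hzero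
  obtain ⟨G, hGae, hGm, hG⟩ := hgood.exists_measurable_mem
  classical
  let Z : Ω → ℝ≥0 → ℝ := fun ω => if ω ∈ G then B ω else 0
  have hZB : ∀ᵐ ω ∂P, Z ω = B ω := by
    filter_upwards [hGae] with ω hω
    exact if_pos hω
  have hc : ∀ ω, Continuous (Z ω) := by
    intro ω
    by_cases h : ω ∈ G
    · simp only [Z, if_pos h]; exact (hG ω h).1
    · simp only [Z, if_neg h]; exact continuous_zero
  have h0 : ∀ ω, Z ω 0 = 0 := by
    intro ω
    by_cases h : ω ∈ G
    · simp only [Z, if_pos h]; exact (hG ω h).2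
    · simp only [Z, if_neg h]; rfl
  have hm : ∀ t, Measurable (fun ω => Z ω t) := by
    intro t
    have : (fun ω => Z ω t) = fun ω => if ω ∈ G then B ω t else 0 := by
      funext ω
      by_cases h : ω ∈ G
      · simp only [Z, if_pos h]
      · simp only [Z, if_neg h]; rfl
    rw [this]
    exact Measurable.ite hGm (hBm t) measurable_const
  have hZ : IsPreBrownianReal (fun t ω => Z ω t) P := by
    refine hpreB.congr fun t => ?_
    filter_upwards [hZB] with ω hω
    rw [hω]
  have hpos : ∀ᵐ ω ∂P, 0 < hitOne (Z ω) := by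
    filter_upwards [ae_exists_ge_one hm hZ] with ω hω
    obtain ⟨t, ht⟩ := hω
    have hex : ∃ s, Z ω s = 1 := by
      have := intermediate_value_Icc (zero_le : (0 : ℝ≥0) ≤ t) (hc ω).continuousOn
      obtain ⟨s, -, hs⟩ := this ⟨by rw [h0]; exact zero_le_one, ht⟩
      exact ⟨s, hs⟩
    have h1 := hitOne_mem (hc ω) hex
    rcases eq_or_ne (hitOne (Z ω)) 0 with h | h
    · rw [h, h0] at h1; exact absurd h1 zero_ne_one
    · exact pos_iff_ne_zero.2 h
  have hXm : ∀ s, Measurable (fun ω => postInc (Z ω) (hitOne (Z ω)) s) := fun s =>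
    (measurable_coAscent hc h0 hm (1 + s)).sub (measurable_coAscent hc h0 hm 1)
  have hYm : Measurable (fun ω => fun s : Set.Icc (0 : ℝ≥0) 1 => brownianCoAscent (Z ω) s) :=
    measurable_pi_lambda _ fun s => measurable_coAscent hc h0 hm s
  have hIm : ∀ I : Finset ℝ≥0, Measurable (fun ω => I.restrict (postInc (Z ω) (hitOne (Z ω)))) :=
    fun I => measurable_pi_lambda _ fun s => hXm s
  have hIZm : ∀ I : Finset ℝ≥0, Measurable (fun ω => I.restrict (Z ω)) :=
    fun I => measurable_pi_lambda _ fun s => hm s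
  have hlaw : ∀ (I : Finset ℝ≥0), P.map (fun ω => I.restrict (postInc (Z ω) (hitOne (Z ω)))) =
      P.map (fun ω => I.restrict (Z ω)) := by
    intro I
    ext A hA
    have h := full_markov hc h0 hm hZ hpos I MeasurableSet.univ hA
    have hu : {ω | (fun s : Set.Icc (0 : ℝ≥0) 1 => brownianCoAscent (Z ω) s) ∈
        (univ : Set (Set.Icc (0 : ℝ≥0) 1 → ℝ))} = univ := by ext; simp
    rw [hu, univ_inter, measure_univ, one_mul] at h
    rw [Measure.map_apply (hIm I) hA]
    exact h
  refine ⟨⟨?_, ?_, ?_⟩, ?_⟩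
  · filter_upwards [hcont] with ω hω
    unfold brownianCoAscent
    fun_prop
  · refine ae_of_all _ fun ω => ?_
    simp
  · intro n c t
    rw [← hlin n c t]
    let I : Finset ℝ≥0 := Finset.univ.image t
    have hI : ∀ i, t i ∈ I := fun i => Finset.mem_image_of_mem t (Finset.mem_univ i)
    let g : (I → ℝ) → ℝ := fun x => ∑ i, c i * x ⟨t i, hI i⟩
    have hg : Measurable g :=
      Finset.measurable_sum _ fun i _ => measurable_const.mul (measurable_pi_apply _)
    have h := congrArg (Measure.map g) (hlaw I)
    rw [Measure.map_map hg (hIm I), Measure.map_map hg (hIZm I)] at h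
    have e1 : (g ∘ fun ω => I.restrict (postInc (Z ω) (hitOne (Z ω)))) =ᵐ[P]
        (fun ω => ∑ i, c i * (brownianCoAscent (B ω) (1 + t i) - brownianCoAscent (B ω) 1)) := by
      filter_upwards [hZB] with ω hω
      simp only [Function.comp, hω]
      rfl
    have e2 : (g ∘ fun ω => I.restrict (Z ω)) =ᵐ[P] (fun ω => ∑ i, c i * B ω (t i)) := by
      filter_upwards [hZB] with ω hω
      simp only [Function.comp, hω]
      rfl
    rw [Measure.map_congr e1, Measure.map_congr e2] at h
    exact h
  · have hind : IndepFun (fun ω s => postInc (Z ω) (hitOne (Z ω)) s)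
        (fun ω => fun s : Set.Icc (0 : ℝ≥0) 1 => brownianCoAscent (Z ω) s) P := by
      refine IndepFun.process_indepFun (X := fun s ω => postInc (Z ω) (hitOne (Z ω)) s)
        hXm hYm fun I => ?_
      rw [indepFun_iff_measure_inter_preimage_eq_mul]
      intro A E hA hE
      have h := full_markov hc h0 hm hZ hpos I hE hA
      rw [← hlaw I, Measure.map_apply (hIm I) hA, mul_comm, inter_comm] at h
      exact h
    refine hind.congr ?_ ?_
    · filter_upwards [hZB] with ω hω
      rw [hω]
      rfl
    · filter_upwards [hZB] with ω hω
      rw [hω]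
end
end
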